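/- Let A = {−1,1}. Then η_A(C_3^2) = 3, η_A(C_3^3) = 5, η_A(C_3^4) = 11, and 21 ≤ η_A(C_3^5) ≤ 23. -/

import Mathlib

/-- A multiset `S` over an additive abelian group `G` has an `A`-zero-sum subsequence
of length `k`, for the weight set `A = {-1, 1}`: there is a sub-multiset of `S` of
cardinality `k` that splits as `t₁ + t₂` with `t₁.sum - t₂.sum = 0` (the elements of
`t₁` receive the weight `+1` and those of `t₂` the weight `-1`). -/
def HasWZSS {G : Type*} [AddCommGroup G] (S : Multiset G) (k : ℕ) : Prop :=
  ∃ t₁ t₂ : Multiset G, t₁ + t₂ ≤ S ∧ Multiset.card (t₁ + t₂) = k ∧ t₁.sum = t₂.sum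

/-- `sA G` is the smallest `ℓ` such that every sequence over `G` of length at least `ℓ`
has an `{-1,1}`-zero-sum subsequence of length `exp G`. -/
noncomputable def sA (G : Type*) [AddCommGroup G] : ℕ :=
  sInf {ℓ : ℕ | ∀ S : Multiset G, ℓ ≤ Multiset.card S →
    HasWZSS S (AddMonoid.exponent G)}

/-- `etaA G` is the smallest `ℓ` such that every sequence over `G` of length at least `ℓ`
has a nonempty `{-1,1}`-zero-sum subsequence of length at most `exp G`. -/
noncomputable def etaA (G : Type*) [AddCommGroup G] : ℕ :=
  sInf {ℓ : ℕ | ∀ S : Multiset G, ℓ ≤ Multiset.card S →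
    ∃ k, 1 ≤ k ∧ k ≤ AddMonoid.exponent G ∧ HasWZSS S k}

/-- `gA G` is the smallest `ℓ` such that every sequence over `G` of length at least `ℓ`
consisting of pairwise distinct elements has an `{-1,1}`-zero-sum subsequence of
length `exp G`. -/
noncomputable def gA (G : Type*) [AddCommGroup G] : ℕ :=
  sInf {ℓ : ℕ | ∀ S : Multiset G, ℓ ≤ Multiset.card S → S.Nodup →
    HasWZSS S (AddMonoid.exponent G)}

def thTab : ℕ := 1502845656160567634247958297053897561202512940067126348461156180334343503660270116258047979257677435258570913575501170535308074382281825435953310576655436669929782612331857563608086582286671942506830780140225533233389656235678728183704906586706377297963394205899046140804830317922874660113820291931348209041307235590907802105907358375785301348301514468320980836939358197923780683152192123931966467768409630184078690169892974729292195199625182285998464517662843085087736686200399135192218167096638841595372742272892738173573205505269584714015355439442668245323524091908721905307181516432747534324849134543398534882525743942689031221739909012437722107543491623450372853333704585084443949694023485396443341919515051119569804131814962106446560950700876268977038242686644820096240690077440633199577431835762511255967118560509939358686469976836622932432822394016721826118648581104079643123241471924949216482440436770801234486152738515809662517927717347640021603128676279988247532759327066107970023722870090716819164094797128833660347159853257034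14262430314847756274864081793451161363173692345587589121088
def badTab : ℕ := 1260504327572715814252157109092271853447361640826722013291205591342812706164199102896754340454190640474226144510316103046847939480550827128660792785060366039314810412407630144577624847896918427939466785334769315165250126
def th (a b : ℕ) : ℕ := Nat.land (Nat.shiftRight thTab (5 * (27 * a + b))) 31
def bad (a : ℕ) : ℕ := Nat.land (Nat.shiftRight badTab (27 * a)) 134217727
def bt (m i : ℕ) : Bool := Nat.beq (Nat.land (Nat.shiftRight m i) 1) 1
def sg (i : ℕ) : ℕ := Nat.shiftLeft 1 i

/-- mask of all `th v t` -/
noncomputable def ths (v : ℕ) (T : List ℕ) (acc : ℕ) : ℕ :=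
  List.rec (motive := fun _ => ℕ) acc (fun t _ ih => Nat.lor ih (sg (th v t))) T
noncomputable def sums (A B : List ℕ) (acc : ℕ) : ℕ :=
  List.rec (motive := fun _ => ℕ) acc (fun a _ ih => ths a B ih) A
noncomputable def subs (A B : List ℕ) (acc : ℕ) : ℕ :=
  List.rec (motive := fun _ => ℕ) acc (fun a _ ih => ths (th a 0) B ih) A

noncomputable def en (leaf : List ℕ → Bool) (l : List ℕ) : ℕ → ℕ → List ℕ → Bool :=
  List.rec (motive := fun _ => ℕ → ℕ → List ℕ → Bool)
    (fun k _ T => cond (Nat.beq k 0) (leaf T) true)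
    (fun v _ ih k forb T => cond (Nat.beq k 0) (leaf T)
      (cond (bt forb v) (ih k forb T)
        (cond (ih (Nat.pred k) (ths v T (Nat.lor forb (bad v))) (v :: T)) (ih k forb T) false))) l

def l26 : List ℕ := [1,2,3,4,5,6,7,8,9,10,11,12,13,14,15,16,17,18,19,20,21,22,23,24,25,26]
def l27 : List ℕ := 0 :: l26
noncomputable def flt (m : ℕ) (l : List ℕ) : List ℕ :=
  List.rec (motive := fun _ => List ℕ) [] (fun v _ ih => cond (bt m v) ih (v :: ih)) l
noncomputable def chkW (k : ℕ) (X Y Z : List ℕ) : Bool :=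
  en (fun _ => false) l27 k (subs X Y (subs Y Z (subs Z X 0))) []
noncomputable def chkXY (k3 k4 : ℕ) (X Y : List ℕ) : Bool :=
  en (chkW k4 X Y) (flt (sums X Y 0) l27) k3 0 []
noncomputable def chk (k1 k3 k4 : ℕ) : Bool :=
  en (fun X => en (fun Y => chkXY k3 k4 X Y) l26 4 (bad 0) [0]) l26 k1 (bad 0) [0]
theorem chk6 : en (fun _ => false) l26 6 (bad 0) [0] = true := by decide +kernel

theorem chkA : chk 4 5 1 = true := by decide +kernel
theorem chkB : chk 5 4 3 = true := by decide +kernel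

theorem bt_eq (m i : ℕ) : bt m i = m.testBit i := by
  have h1 : Nat.land (Nat.shiftRight m i) 1 = (m >>> i) &&& 1 := rfl
  rw [Bool.eq_iff_iff]
  simp only [bt, h1, Nat.beq_eq, Nat.testBit_eq_decide_div_mod_eq, decide_eq_true_eq,
    Nat.and_one_is_mod, Nat.shiftRight_eq_div_pow]

theorem bt_lor (a b i : ℕ) : bt (Nat.lor a b) i = (bt a i || bt b i) := by
  simp only [bt_eq]; exact Nat.testBit_or a b i

theorem bt_sg (a i : ℕ) : bt (sg a) i = true ↔ a = i := by
  have : sg a = 2 ^ a := by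
    change 1 <<< a = 2 ^ a
    rw [Nat.one_shiftLeft]
  rw [bt_eq, this, Nat.testBit_two_pow, decide_eq_true_eq]

theorem bt_zero (i : ℕ) : bt 0 i = false := by simp [bt_eq]

theorem bt_ths (v : ℕ) (T : List ℕ) (acc u : ℕ) :
    bt (ths v T acc) u = true ↔ bt acc u = true ∨ ∃ t ∈ T, th v t = u := by
  induction T with
  | nil => simp [ths]
  | cons t T ih =>
    have : ths v (t :: T) acc = Nat.lor (ths v T acc) (sg (th v t)) := rfl
    rw [this, bt_lor, Bool.or_eq_true, ih, bt_sg]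
    simp only [List.mem_cons, exists_eq_or_imp]
    rw [or_assoc]; exact or_congr_right or_comm

theorem bt_sums (A B : List ℕ) (acc u : ℕ) :
    bt (sums A B acc) u = true ↔ bt acc u = true ∨ ∃ a ∈ A, ∃ b ∈ B, th a b = u := by
  induction A with
  | nil => simp [sums]
  | cons t T ih =>
    have : sums (t :: T) B acc = ths t B (sums T B acc) := rfl
    rw [this, bt_ths, ih]
    simp only [List.mem_cons, exists_eq_or_imp]
    rw [or_assoc]; exact or_congr_right or_comm

theorem bt_subs (A B : List ℕ) (acc u : ℕ) :
    bt (subs A B acc) u = true ↔ bt acc u = true ∨ ∃ a ∈ A, ∃ b ∈ B, th (th a 0) b = u := by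
  induction A with
  | nil => simp [subs]
  | cons t T ih =>
    have : subs (t :: T) B acc = ths (th t 0) B (subs T B acc) := rfl
    rw [this, bt_ths, ih]
    simp only [List.mem_cons, exists_eq_or_imp]
    rw [or_assoc]; exact or_congr_right or_comm

theorem mem_flt (m : ℕ) (l : List ℕ) (u : ℕ) : u ∈ flt m l ↔ u ∈ l ∧ bt m u = false := by
  induction l with
  | nil => simp [flt]
  | cons v l ih =>
    have : flt m (v :: l) = cond (bt m v) (flt m l) (v :: flt m l) := rfl
    rw [this]
    cases h : bt m v
    · simp only [cond_false, List.mem_cons, ih]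
      constructor
      · rintro (rfl | ⟨h1, h2⟩)
        · exact ⟨Or.inl rfl, h⟩
        · exact ⟨Or.inr h1, h2⟩
      · rintro ⟨rfl | h1, h2⟩
        · exact Or.inl rfl
        · exact Or.inr ⟨h1, h2⟩
    · simp only [cond_true, List.mem_cons, ih]
      constructor
      · rintro ⟨h1, h2⟩
        exact ⟨Or.inr h1, h2⟩
      · rintro ⟨rfl | h1, h2⟩
        · rw [h] at h2; cases h2
        · exact ⟨h1, h2⟩

theorem nodup_flt (m : ℕ) (l : List ℕ) (hl : l.Nodup) : (flt m l).Nodup := by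
  induction l with
  | nil => simp [flt]
  | cons v l ih =>
    have : flt m (v :: l) = cond (bt m v) (flt m l) (v :: flt m l) := rfl
    rw [this]
    rw [List.nodup_cons] at hl
    cases h : bt m v
    · simp only [cond_false, List.nodup_cons, mem_flt]
      exact ⟨fun h => hl.1 h.1, ih hl.2⟩
    · exact ih hl.2

/-- Admissible sets of codes. -/
structure Adm (X : Finset ℕ) : Prop where
  lt : ∀ m ∈ X, m < 27
  bad : ∀ m ∈ X, ∀ n ∈ X, m ≠ n → bt (bad m) n = false
  th : ∀ m ∈ X, ∀ n ∈ X, m ≠ n → th m n ∉ X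

theorem en_sound {X : Finset ℕ} (hX : Adm X) (leaf : List ℕ → Bool) (l : List ℕ) :
    ∀ (k forb : ℕ) (T : List ℕ), l.Nodup → (∀ v ∈ T, v ∈ X) → (∀ v ∈ T, v ∉ l) →
      (∀ v ∈ X, v ∈ l → bt forb v = false) → k ≤ (X.filter (· ∈ l)).card →
      en leaf l k forb T = true → ∃ T' : List ℕ, (∀ v ∈ T', v ∈ X) ∧ leaf T' = true := by
  induction l with
  | nil =>
    intro k forb T _ hT _ _ hk h
    have hk0 : k = 0 := by simpa using hk
    subst hk0
    exact ⟨T, hT, h⟩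
  | cons v l ih =>
    intro k forb T hl hT hTl hf hk h
    rw [List.nodup_cons] at hl
    have e : en leaf (v :: l) k forb T = cond (Nat.beq k 0) (leaf T)
      (cond (bt forb v) (en leaf l k forb T)
        (cond (en leaf l (Nat.pred k) (ths v T (Nat.lor forb (bad v))) (v :: T))
          (en leaf l k forb T) false)) := rfl
    rw [e] at h
    rcases k with _ | k
    · exact ⟨T, hT, h⟩
    · have h' : cond (bt forb v) (en leaf l (k+1) forb T)
        (cond (en leaf l k (ths v T (Nat.lor forb (bad v))) (v :: T))
          (en leaf l (k+1) forb T) false) = true := h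
      by_cases hv : v ∈ X
      · rw [hf v hv (by simp)] at h'
        have h2 : en leaf l k (ths v T (Nat.lor forb (bad v))) (v :: T) = true := by
          cases h3 : en leaf l k (ths v T (Nat.lor forb (bad v))) (v :: T)
          · rw [h3] at h'; cases h'
          · rfl
        refine ih k _ (v :: T) hl.2 ?_ ?_ ?_ ?_ h2
        · intro u hu
          rcases List.mem_cons.1 hu with rfl | hu
          · exact hv
          · exact hT u hu
        · intro u hu
          rcases List.mem_cons.1 hu with rfl | hu
          · exact hl.1
          · exact fun h => hTl u hu (by simp [h])
        · intro u hu hul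
          have huv : v ≠ u := by rintro rfl; exact hl.1 hul
          rw [Bool.eq_false_iff]
          intro hb
          rw [bt_ths, bt_lor, hf u hu (by simp [hul]), hX.bad v hv u hu huv] at hb
          rcases hb with hb | ⟨t, ht, htu⟩
          · cases hb
          · refine hX.th v hv t (hT t ht) ?_ (htu ▸ hu)
            rintro rfl
            exact hTl _ ht (by simp)
        · have : X.filter (· ∈ v :: l) = insert v (X.filter (· ∈ l)) := by
            ext u
            simp only [Finset.mem_filter, List.mem_cons, Finset.mem_insert]
            constructor
            · rintro ⟨h1, h2 | h2⟩
              · exact Or.inl h2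
              · exact Or.inr ⟨h1, h2⟩
            · rintro (rfl | ⟨h1, h2⟩)
              · exact ⟨hv, Or.inl rfl⟩
              · exact ⟨h1, Or.inr h2⟩
          rw [this, Finset.card_insert_of_notMem (by simp [hl.1])] at hk
          omega
      · have h2 : en leaf l (k+1) forb T = true := by
          cases hb : bt forb v
          · rw [hb] at h'
            cases h3 : en leaf l k (ths v T (Nat.lor forb (bad v))) (v :: T)
            · rw [h3] at h'; cases h'
            · rw [h3] at h'; exact h'
          · rw [hb] at h'; exact h'
        refine ih (k+1) forb T hl.2 hT (fun u hu h => hTl u hu (by simp [h]))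
          (fun u hu h => hf u hu (by simp [h])) ?_ h2
        refine hk.trans (Finset.card_le_card ?_)
        intro u
        simp only [Finset.mem_filter, List.mem_cons]
        rintro ⟨h1, h2 | h2⟩
        · exact absurd (h2 ▸ h1) hv
        · exact ⟨h1, h2⟩

theorem mem_l27 {v : ℕ} (h : v < 27) : v ∈ l27 := by
  revert v; decide

theorem mem_l26 {v : ℕ} (h : v < 27) (h0 : v ≠ 0) : v ∈ l26 := by
  have := mem_l27 h
  rcases List.mem_cons.1 this with h | h
  · exact absurd h h0
  · exact h

theorem en_sound0 {X : Finset ℕ} (hX : Adm X) (h0 : 0 ∈ X) (leaf : List ℕ → Bool) (k : ℕ)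
    (hk : k + 1 ≤ X.card) (h : en leaf l26 k (bad 0) [0] = true) :
    ∃ T' : List ℕ, (∀ v ∈ T', v ∈ X) ∧ leaf T' = true := by
  refine en_sound hX leaf l26 k (bad 0) [0] (by decide) (by simpa using h0)
    (by intro v hv; rw [List.mem_singleton.1 hv]; decide) ?_ ?_ h
  · intro v hv hl
    refine hX.bad 0 h0 v hv ?_
    rintro rfl
    revert hl; decide
  · have : X.erase 0 ⊆ X.filter (· ∈ l26) := by
      intro u hu
      rw [Finset.mem_erase] at hu
      exact Finset.mem_filter.2 ⟨hu.2, mem_l26 (hX.lt u hu.2) hu.1⟩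
    have := Finset.card_le_card this
    rw [Finset.card_erase_of_mem h0] at this
    omega

theorem en_sound_all {X : Finset ℕ} (hX : Adm X) (leaf : List ℕ → Bool) (l : List ℕ) (k : ℕ)
    (forb : ℕ) (hl : l.Nodup) (hXl : ∀ v ∈ X, v ∈ l) (hf : ∀ v ∈ X, bt forb v = false)
    (hk : k ≤ X.card) (h : en leaf l k forb [] = true) :
    ∃ T' : List ℕ, (∀ v ∈ T', v ∈ X) ∧ leaf T' = true := by
  refine en_sound hX leaf l k forb [] hl (by simp) (by simp) (fun v hv _ => hf v hv) ?_ h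
  rwa [Finset.filter_true_of_mem hXl]

theorem card_le_six {X : Finset ℕ} (hX : Adm X) (h0 : 0 ∈ X) : X.card ≤ 6 := by
  by_contra h
  obtain ⟨T, _, hT⟩ := en_sound0 hX h0 _ 6 (by omega) chk6
  cases hT

theorem chk_sound (k1 k3 k4 : ℕ) (hc : chk k1 k3 k4 = true) {X Y Z W : Finset ℕ}
    (hX : Adm X) (hY : Adm Y) (hZ : Adm Z) (hW : Adm W) (hX0 : 0 ∈ X) (hY0 : 0 ∈ Y)
    (hXc : k1 + 1 ≤ X.card) (hYc : 5 ≤ Y.card) (hZc : k3 ≤ Z.card) (hWc : k4 ≤ W.card)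
    (hXYZ : ∀ x ∈ X, ∀ y ∈ Y, th x y ∉ Z)
    (hXY : ∀ x ∈ X, ∀ y ∈ Y, th (th x 0) y ∉ W)
    (hYZ : ∀ x ∈ Y, ∀ y ∈ Z, th (th x 0) y ∉ W)
    (hZX : ∀ x ∈ Z, ∀ y ∈ X, th (th x 0) y ∉ W) : False := by
  obtain ⟨A, hA, h1⟩ := en_sound0 hX hX0 _ k1 hXc hc
  obtain ⟨B, hB, h2⟩ := en_sound0 hY hY0 _ 4 hYc h1
  obtain ⟨C, hC, h3⟩ := en_sound_all hZ _ _ k3 0 (nodup_flt _ _ (by decide)) (by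
    intro v hv
    rw [mem_flt]
    refine ⟨mem_l27 (hZ.lt v hv), ?_⟩
    rw [Bool.eq_false_iff]
    intro hb
    rw [bt_sums, bt_zero] at hb
    rcases hb with hb | ⟨a, ha, b, hb, rfl⟩
    · cases hb
    · exact hXYZ a (hA a ha) b (hB b hb) hv) (fun v _ => bt_zero v) hZc h2
  obtain ⟨D, hD, h4⟩ := en_sound_all hW _ _ k4 _ (by decide) (fun v hv => mem_l27 (hW.lt v hv)) (by
    intro v hv
    rw [Bool.eq_false_iff]
    intro hb
    rw [bt_subs, bt_subs, bt_subs, bt_zero] at hb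
    rcases hb with ((hb | ⟨a, ha, b, hb, rfl⟩) | ⟨a, ha, b, hb, rfl⟩) | ⟨a, ha, b, hb, rfl⟩
    · cases hb
    · exact hZX a (hC a ha) b (hA b hb) hv
    · exact hYZ a (hB a ha) b (hC b hb) hv
    · exact hXY a (hA a ha) b (hB b hb) hv) hWc h3
  cases h4

/-- A symmetric set of vectors representing a projective cap. -/
structure Cap {V : Type*} [AddCommGroup V] (U : Finset V) : Prop where
  zero : (0 : V) ∉ U
  neg : ∀ x ∈ U, -x ∈ U
  cap : ∀ x ∈ U, ∀ y ∈ U, x ≠ y → x ≠ -y → x + y ∉ U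

set_option linter.unusedSectionVars false

section
variable {V : Type*} [AddCommGroup V] [Module (ZMod 3) V]

theorem nsmul3 (v : V) : 3 • v = 0 := by
  have : ((3 : ℕ) : ZMod 3) • v = 0 := by
    have h : ((3 : ℕ) : ZMod 3) = 0 := by decide
    rw [h, zero_smul]
  rwa [Nat.cast_smul_eq_nsmul] at this

theorem three_add (v : V) : v + v + v = 0 := by
  have := nsmul3 (V := V) v
  rwa [succ_nsmul, two_nsmul] at this

theorem zmod3_cases (a : ZMod 3) : a = 0 ∨ a = 1 ∨ a = -1 := by
  revert a; decide

theorem Cap.sub {U : Finset V} (h : Cap U) {x y : V} (hx : x ∈ U) (hy : y ∈ U) (h1 : x ≠ y)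
    (h2 : x ≠ -y) : x - y ∉ U := by
  rw [sub_eq_add_neg]
  exact h.cap x hx (-y) (h.neg y hy) h2 (by simpa using h1)

theorem Cap.smul_mem {U : Finset V} (h : Cap U) {x : V} (hx : x ∈ U) {a : ZMod 3} (ha : a ≠ 0) :
    a • x ∈ U := by
  rcases zmod3_cases a with rfl | rfl | rfl
  · exact absurd rfl ha
  · simpa using hx
  · simpa using h.neg x hx

theorem eq_neg_of_mem {W : Submodule (ZMod 3) V} {x y : V} (hx : x ∉ W) (h : y - x ∈ W) :
    x ≠ -y := by
  intro e
  apply hx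
  have : y - x = x := by
    have := three_add x
    have e2 : y = -x := by rw [e, neg_neg]
    rw [e2]
    have h3 : -x - x - x = 0 := by
      have : -x - x - x = -(x + x + x) := by abel
      rw [this, three_add, neg_zero]
    exact sub_eq_zero.1 h3
  rwa [this] at h

variable [DecidableEq V]

/-- coefficients of a difference of two cap points in a coset of a secant -/
theorem fib2_aux {U : Finset V} (h : Cap U) {p q x y : V} (hp : p ∈ U) (hq : q ∈ U)
    (hx : x ∈ U) (hy : y ∈ U) (hxy : x ≠ y) (hxy' : x ≠ -y) {a b : ZMod 3}
    (hab : a • p + b • q = y - x) : a ≠ 0 ∧ b ≠ 0 := by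
  have hns : y - x ∉ U := h.sub hy hx hxy.symm (fun e => hxy' (by rw [e, neg_neg]))
  constructor
  · rintro rfl
    rw [zero_smul, zero_add] at hab
    by_cases hb : b = 0
    · rw [hb, zero_smul] at hab
      exact hxy (sub_eq_zero.1 hab.symm).symm
    · exact hns (hab ▸ h.smul_mem hq hb)
  · rintro rfl
    rw [zero_smul, add_zero] at hab
    by_cases hb : a = 0
    · rw [hb, zero_smul] at hab
      exact hxy (sub_eq_zero.1 hab.symm).symm
    · exact hns (hab ▸ h.smul_mem hp hb)

theorem fib2 {U : Finset V} (h : Cap U) {p q : V} (hp : p ∈ U) (hq : q ∈ U)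
    (c : V ⧸ Submodule.span (ZMod 3) {p, q}) (hc : c ≠ 0)
    [DecidableEq (V ⧸ Submodule.span (ZMod 3) {p, q})] :
    (U.filter (fun u => Submodule.Quotient.mk (p := Submodule.span (ZMod 3) {p, q}) u = c)).card
      ≤ 2 := by
  by_contra hcon
  rw [not_le, Finset.two_lt_card] at hcon
  obtain ⟨x, hx, y, hy, z, hz, hxy, hxz, hyz⟩ := hcon
  rw [Finset.mem_filter] at hx hy hz
  obtain ⟨hx, hxc⟩ := hx
  obtain ⟨hy, hyc⟩ := hy
  obtain ⟨hz, hzc⟩ := hz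
  have hxW : x ∉ Submodule.span (ZMod 3) {p, q} := by
    intro hm
    rw [← Submodule.Quotient.mk_eq_zero, hxc] at hm
    exact hc hm
  have hyW : y ∉ Submodule.span (ZMod 3) {p, q} := by
    intro hm
    rw [← Submodule.Quotient.mk_eq_zero, hyc] at hm
    exact hc hm
  have h1 : y - x ∈ Submodule.span (ZMod 3) {p, q} :=
    (Submodule.Quotient.eq _).1 (hyc.trans hxc.symm)
  have h2 : z - x ∈ Submodule.span (ZMod 3) {p, q} :=
    (Submodule.Quotient.eq _).1 (hzc.trans hxc.symm)
  have h3 : z - y ∈ Submodule.span (ZMod 3) {p, q} :=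
    (Submodule.Quotient.eq _).1 (hzc.trans hyc.symm)
  have n1 := eq_neg_of_mem hxW h1
  have n2 := eq_neg_of_mem hxW h2
  have n3 := eq_neg_of_mem hyW h3
  obtain ⟨a, b, hab⟩ := Submodule.mem_span_pair.1 h1
  obtain ⟨a', b', hab'⟩ := Submodule.mem_span_pair.1 h2
  have hd : (a' - a) • p + (b' - b) • q = z - y := by
    have : z - y = (z - x) - (y - x) := by abel
    rw [this, ← hab, ← hab', sub_smul, sub_smul]; abel
  obtain ⟨ha, hb⟩ := fib2_aux h hp hq hx hy hxy n1 hab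
  obtain ⟨ha', hb'⟩ := fib2_aux h hp hq hx hz hxz n2 hab'
  obtain ⟨ha'', hb''⟩ := fib2_aux h hp hq hy hz hyz n3 hd
  have key : ∀ s t : ZMod 3, s ≠ 0 → t ≠ 0 → t - s ≠ 0 → t = - s := by decide
  have ea := key a a' ha ha' ha''
  have eb := key b b' hb hb' hb''
  have hzx : z - x = -(y - x) := by
    rw [← hab, ← hab', ea, eb, neg_smul, neg_smul]; abel
  have hs : x + y = -z := by
    have h3x := three_add x
    have : x + y + z = (z - x) + (y - x) + (x + x + x) := by abel
    rw [hzx, h3x] at this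
    rw [eq_neg_iff_add_eq_zero, this]; abel
  exact h.cap x hx y hy hxy n1 (hs ▸ h.neg z hz)

theorem fib2_zero {U : Finset V} (h : Cap U) {p q : V} (hp : p ∈ U) (hq : q ∈ U) (hpq : p ≠ q)
    (hpq' : p ≠ -q) [DecidableEq (V ⧸ Submodule.span (ZMod 3) {p, q})] :
    (U.filter (fun u => Submodule.Quotient.mk (p := Submodule.span (ZMod 3) {p, q}) u = 0)).card
      ≤ 4 := by
  have hs : U.filter (fun u => Submodule.Quotient.mk (p := Submodule.span (ZMod 3) {p, q}) u = 0)
      ⊆ {p, -p, q, -q} := by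
    intro u hu
    rw [Finset.mem_filter, Submodule.Quotient.mk_eq_zero] at hu
    obtain ⟨hu, hm⟩ := hu
    obtain ⟨a, b, rfl⟩ := Submodule.mem_span_pair.1 hm
    by_cases ha : a = 0
    · subst ha
      rcases zmod3_cases b with rfl | rfl | rfl
      · exact absurd (by simpa using hu) h.zero
      · simp
      · simp
    · by_cases hb : b = 0
      · subst hb
        rcases zmod3_cases a with rfl | rfl | rfl
        · exact absurd rfl ha
        · simp
        · simp
      · exfalso
        refine h.cap _ (h.smul_mem hp ha) _ (h.smul_mem hq hb) ?_ ?_ hu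
        · rcases zmod3_cases a with rfl | rfl | rfl <;> rcases zmod3_cases b with rfl | rfl | rfl <;>
            simp_all [neg_eq_iff_eq_neg]
        · rcases zmod3_cases a with rfl | rfl | rfl <;> rcases zmod3_cases b with rfl | rfl | rfl <;>
            simp_all [neg_eq_iff_eq_neg]
  exact (Finset.card_le_card hs).trans Finset.card_le_four

theorem finrank_pair {p q : V} [Finite V] (hp : p ≠ 0) (hq : q ≠ 0) (hpq : p ≠ q)
    (hpq' : p ≠ -q) : Module.finrank (ZMod 3) (Submodule.span (ZMod 3) {p, q}) = 2 := by
  have hli : LinearIndependent (ZMod 3) ![p, q] := by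
    rw [LinearIndependent.pair_iff]
    intro a b hab
    rcases zmod3_cases a with rfl | rfl | rfl <;> rcases zmod3_cases b with rfl | rfl | rfl <;>
            simp_all [neg_eq_iff_eq_neg, add_eq_zero_iff_eq_neg]
  have := finrank_span_eq_card hli
  have e : Set.range ![p, q] = {p, q} := by
    rw [Matrix.range_cons_cons_empty]
  rwa [e, Fintype.card_fin] at this

theorem card_quot [Finite V] (W : Submodule (ZMod 3) V) {r s : ℕ}
    (hV : Module.finrank (ZMod 3) V = r + s) (hW : Module.finrank (ZMod 3) W = s)
    [Fintype (V ⧸ W)] : Fintype.card (V ⧸ W) = 3 ^ r := by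
  have := Submodule.finrank_quotient_add_finrank W
  have e : Module.finrank (ZMod 3) (V ⧸ W) = r := by omega
  rw [Module.card_eq_pow_finrank (K := ZMod 3), e, ZMod.card]

theorem exists_pair {U : Finset V} (hU : 2 < U.card) :
    ∃ p ∈ U, ∃ q ∈ U, p ≠ q ∧ p ≠ -q := by
  rw [Finset.two_lt_card] at hU
  obtain ⟨x, hx, y, hy, z, hz, hxy, hxz, hyz⟩ := hU
  by_cases h1 : x = -y
  · refine ⟨x, hx, z, hz, hxz, ?_⟩
    rintro rfl
    exact hyz (neg_injective h1).symm
  · exact ⟨x, hx, y, hy, hxy, h1⟩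

open Classical in
theorem card_eq_sum_fib [Finite V] (U : Finset V) (W : Submodule (ZMod 3) V) [Fintype (V ⧸ W)] :
    U.card = ∑ c : V ⧸ W, (U.filter (fun u => Submodule.Quotient.mk (p := W) u = c)).card :=
  Finset.card_eq_sum_card_fiberwise (fun _ _ => Finset.mem_coe.2 (Finset.mem_univ _))

open Classical in
theorem cap_bound [Finite V] {U : Finset V} (h : Cap U) {r : ℕ}
    (hr : Module.finrank (ZMod 3) V = r + 2) : U.card ≤ 2 + 2 * 3 ^ r := by
  have h3 : 1 ≤ 3 ^ r := Nat.one_le_pow _ _ (by norm_num)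
  by_cases hU : 2 < U.card
  swap
  · omega
  obtain ⟨p, hp, q, hq, hpq, hpq'⟩ := exists_pair hU
  let W := Submodule.span (ZMod 3) {p, q}
  have : Finite (V ⧸ W) := Finite.of_surjective _ (Submodule.Quotient.mk_surjective W)
  have : Fintype (V ⧸ W) := Fintype.ofFinite _
  have hW : Module.finrank (ZMod 3) W = 2 :=
    finrank_pair (fun e => h.zero (e ▸ hp)) (fun e => h.zero (e ▸ hq)) hpq hpq'
  have hc := card_quot W hr hW
  rw [card_eq_sum_fib U W, ← Finset.add_sum_erase _ _ (Finset.mem_univ (0 : V ⧸ W))]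
  have h0 := fib2_zero h hp hq hpq hpq'
  have hs := Finset.sum_le_card_nsmul (Finset.univ.erase (0 : V ⧸ W))
    (fun c => (U.filter (fun u => Submodule.Quotient.mk (p := W) u = c)).card) 2
    (fun c hc => fib2 h hp hq c (Finset.ne_of_mem_erase hc))
  rw [Finset.card_erase_of_mem (Finset.mem_univ _), Finset.card_univ, hc, smul_eq_mul] at hs
  have h0' : (U.filter (fun u => Submodule.Quotient.mk (p := W) u = 0)).card ≤ 4 := h0
  omega
end

theorem th_spec : ∀ m < 27, ∀ n < 27, th m n < 27 ∧ (th m n % 3 + m % 3 + n % 3) % 3 = 0 ∧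
    (th m n / 3 % 3 + m / 3 % 3 + n / 3 % 3) % 3 = 0 ∧
    (th m n / 9 + m / 9 + n / 9) % 3 = 0 := by decide +kernel

theorem bad_spec : ∀ m < 27, ∀ n < 27, bt (bad m) n = true →
    ∃ f ∈ [1, 2, 3, 6, 9, 13, 18, 26], n = th (th m f) 0 := by decide +kernel

section
variable {V : Type*} [AddCommGroup V] [Module (ZMod 3) V]

/-- the vector with a given code -/
def psi (p q x : V) (n : ℕ) : V := (n % 3) • p + (n / 3 % 3) • q + (n / 9) • x

theorem nsmul_of_mod (v : V) {k : ℕ} (h : k % 3 = 0) : k • v = 0 := by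
  obtain ⟨j, rfl⟩ := Nat.dvd_of_mod_eq_zero h
  rw [mul_comm, mul_nsmul', nsmul3, nsmul_zero]

theorem psi_th (p q x : V) {m n : ℕ} (hm : m < 27) (hn : n < 27) :
    psi p q x (th m n) = -(psi p q x m + psi p q x n) := by
  obtain ⟨-, h1, h2, h3⟩ := th_spec m hm n hn
  rw [eq_neg_iff_add_eq_zero]
  have e1 := nsmul_of_mod p h1
  have e2 := nsmul_of_mod q h2
  have e3 := nsmul_of_mod x h3
  simp only [add_nsmul] at e1 e2 e3
  unfold psi
  calc _ = (((th m n % 3) • p + (m % 3) • p + (n % 3) • p)) +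
      ((th m n / 3 % 3) • q + (m / 3 % 3) • q + (n / 3 % 3) • q) +
      ((th m n / 9) • x + (m / 9) • x + (n / 9) • x) := by abel
    _ = 0 := by rw [e1, e2, e3]; simp

theorem psi_zero (p q x : V) : psi p q x 0 = 0 := by simp [psi]

theorem psi_sub (p q x : V) {m n : ℕ} (hm : m < 27) (hn : n < 27) :
    psi p q x (th (th m 0) n) = psi p q x m - psi p q x n := by
  rw [psi_th p q x (th_spec m hm 0 (by norm_num)).1 hn, psi_th p q x hm (by norm_num), psi_zero]
  abel

theorem psi_add (p q x : V) {m n : ℕ} (hm : m < 27) (hn : n < 27) :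
    psi p q x (th (th m n) 0) = psi p q x m + psi p q x n := by
  rw [psi_th p q x (th_spec m hm n hn).1 (by norm_num), psi_th p q x hm hn, psi_zero]
  abel

theorem two_smul_neg (v : V) : 2 • v = -v := by
  rw [eq_neg_iff_add_eq_zero, two_nsmul, three_add]

theorem psi_frame {U : Finset V} (h : Cap U) {p q x : V} (hp : p ∈ U) (hq : q ∈ U) (hx : x ∈ U)
    (hs : p + q + x ∈ U) {f : ℕ} (hf : f ∈ [1, 2, 3, 6, 9, 13, 18, 26]) : psi p q x f ∈ U := by
  simp only [List.mem_cons, List.not_mem_nil, or_false] at hf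
  have h1 := h.neg p hp
  have h2 := h.neg q hq
  have h3 := h.neg x hx
  have h4 := h.neg _ hs
  have e : -(p + q + x) = -p + -q + -x := by abel
  rw [e] at h4
  rcases hf with rfl | rfl | rfl | rfl | rfl | rfl | rfl | rfl <;>
    simpa [psi, two_smul_neg] using by assumption

theorem psi_mem {W : Submodule (ZMod 3) V} {p q x : V} (hp : p ∈ W) (hq : q ∈ W) (hx : x ∈ W)
    (n : ℕ) : psi p q x n ∈ W :=
  W.add_mem (W.add_mem (nsmul_mem hp _) (nsmul_mem hq _)) (nsmul_mem hx _)

theorem exists_code {p q x w : V} (hw : w ∈ Submodule.span (ZMod 3) {p, q, x}) :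
    ∃ n < 27, psi p q x n = w := by
  obtain ⟨a, b, c, rfl⟩ := Submodule.mem_span_triple.1 hw
  have ha : a.val < 3 := ZMod.val_lt a
  have hb : b.val < 3 := ZMod.val_lt b
  have hc : c.val < 3 := ZMod.val_lt c
  refine ⟨a.val + 3 * b.val + 9 * c.val, by omega, ?_⟩
  have e1 : (a.val + 3 * b.val + 9 * c.val) % 3 = a.val := by omega
  have e2 : (a.val + 3 * b.val + 9 * c.val) / 3 % 3 = b.val := by omega
  have e3 : (a.val + 3 * b.val + 9 * c.val) / 9 = c.val := by omega
  have key : ∀ (t : ZMod 3) (v : V), t.val • v = t • v := by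
    intro t v
    rw [← Nat.cast_smul_eq_nsmul (ZMod 3), ZMod.natCast_zmod_val]
  rw [psi, e1, e2, e3, key, key, key]

theorem sep {U : Finset V} (h : Cap U) {W : Submodule (ZMod 3) V} {a b v w : V}
    (hv : v ∈ W) (hw : w ∈ W) (h1 : a - b ∉ W) (h2 : a + b ∉ W)
    (hu : a + v ∈ U) (hu' : b + w ∈ U) :
    (a + v) + (b + w) ∉ U ∧ (a + v) - (b + w) ∉ U := by
  have n1 : a + v ≠ b + w := by
    intro e
    apply h1
    have : a - b = w - v := by rw [sub_eq_sub_iff_add_eq_add, e, add_comm]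
    rw [this]; exact W.sub_mem hw hv
  have n2 : a + v ≠ -(b + w) := by
    intro e
    apply h2
    have : a + b = -(v + w) := by
      rw [eq_neg_iff_add_eq_zero] at e ⊢
      rw [← e]; abel
    rw [this]; exact W.neg_mem (W.add_mem hv hw)
  exact ⟨h.cap _ hu _ hu' n1 n2, h.sub hu hu' n1 n2⟩

open Classical in
/-- fibre of the cap over the class of `a` -/
noncomputable def fib (U : Finset V) (W : Submodule (ZMod 3) V) (a : V) : Finset V :=
  U.filter (fun u => u - a ∈ W)

/-- For each `a` there is a set of codes for the fibre over `a`. -/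
theorem exists_codes {U : Finset V} (h : Cap U) {p q x : V} (hp : p ∈ U) (hq : q ∈ U) (hx : x ∈ U)
    (hs : p + q + x ∈ U) (a : V) (ha : a ∉ Submodule.span (ZMod 3) {p, q, x}) :
    ∃ X : Finset ℕ, Adm X ∧ X.card = (fib U (Submodule.span (ZMod 3) {p, q, x}) a).card ∧
      (∀ n ∈ X, a + psi p q x n ∈ U) ∧ (a ∈ U → 0 ∈ X) := by
  classical
  set W := Submodule.span (ZMod 3) {p, q, x} with hW
  have hpW : p ∈ W := Submodule.subset_span (by simp)
  have hqW : q ∈ W := Submodule.subset_span (by simp)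
  have hxW : x ∈ W := Submodule.subset_span (by simp)
  have : ∀ w : V, ∃ n : ℕ, (w ∈ W → n < 27 ∧ psi p q x n = w) ∧ (w = 0 → n = 0) := by
    intro w
    by_cases h0 : w = 0
    · exact ⟨0, fun _ => ⟨by norm_num, by rw [h0, psi_zero]⟩, fun _ => rfl⟩
    · by_cases hw : w ∈ W
      · obtain ⟨n, hn, e⟩ := exists_code hw
        exact ⟨n, fun _ => ⟨hn, e⟩, fun h => absurd h h0⟩
      · exact ⟨0, fun h => absurd h hw, fun _ => rfl⟩
  choose c hc hc0 using this
  have hmem : ∀ n ∈ (fib U W a).image (fun u => c (u - a)),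
      n < 27 ∧ a + psi p q x n ∈ U ∧ c (psi p q x n) = n := by
    intro n hn
    obtain ⟨u, hu, rfl⟩ := Finset.mem_image.1 hn
    obtain ⟨hu, hua⟩ := Finset.mem_filter.1 hu
    obtain ⟨h1, h2⟩ := hc _ hua
    refine ⟨h1, ?_, by rw [h2]⟩
    rw [h2]
    simpa using hu
  have hne : ∀ m n, a + psi p q x m ≠ -(a + psi p q x n) := by
    intro m n
    refine eq_neg_of_mem (W := W) ?_ ?_
    · intro hm
      exact ha ((W.add_mem_iff_left (psi_mem hpW hqW hxW m)).1 hm)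
    · rw [add_sub_add_left_eq_sub]
      exact W.sub_mem (psi_mem hpW hqW hxW _) (psi_mem hpW hqW hxW _)
  refine ⟨(fib U W a).image (fun u => c (u - a)), ⟨fun n hn => (hmem n hn).1, ?_, ?_⟩, ?_,
    fun n hn => (hmem n hn).2.1, ?_⟩
  · intro m hm n hn _
    rw [Bool.eq_false_iff]
    intro hb
    obtain ⟨m1, m2, m3⟩ := hmem m hm
    obtain ⟨n1, n2, n3⟩ := hmem n hn
    obtain ⟨f, hf, e⟩ := bad_spec m m1 n n1 hb
    have hfU := psi_frame h hp hq hx hs hf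
    have hf27 : f < 27 := by
      simp only [List.mem_cons, List.not_mem_nil, or_false] at hf
      omega
    have e2 : a + psi p q x n = (a + psi p q x m) + psi p q x f := by
      rw [e, psi_add p q x m1 hf27]; abel
    have e3 : psi p q x f = (a + psi p q x n) - (a + psi p q x m) := by rw [e2]; abel
    refine h.sub n2 m2 ?_ (hne _ _) (e3 ▸ hfU)
    intro e4
    rw [e4, sub_self] at e3
    exact h.zero (e3 ▸ hfU)
  · intro m hm n hn hmn hk
    obtain ⟨m1, m2, m3⟩ := hmem m hm
    obtain ⟨n1, n2, n3⟩ := hmem n hn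
    obtain ⟨k1, k2, k3⟩ := hmem _ hk
    rw [psi_th p q x m1 n1] at k2
    refine h.cap _ m2 _ n2 ?_ (hne _ _) ?_
    · intro e
      have e := add_left_cancel e
      exact hmn (by rw [← m3, ← n3, e])
    · have := h.neg _ k2
      have e : -(a + -(psi p q x m + psi p q x n)) =
          (a + psi p q x m) + (a + psi p q x n) - (a + a + a) := by abel
      rwa [e, three_add, sub_zero] at this
  · refine Finset.card_image_of_injOn ?_
    intro u hu v hv e
    have e : c (u - a) = c (v - a) := e
    have h1 := (hc _ (Finset.mem_filter.1 hu).2).2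
    have h2 := (hc _ (Finset.mem_filter.1 hv).2).2
    rw [e, h2] at h1
    exact (sub_left_injective h1).symm
  · intro haU
    refine Finset.mem_image.2 ⟨a, Finset.mem_filter.2 ⟨haU, by simp⟩, hc0 _ (by simp)⟩

theorem final {U : Finset V} (h : Cap U) {p q x : V} (hp : p ∈ U) (hq : q ∈ U) (hx : x ∈ U)
    (hs : p + q + x ∈ U) {W : Submodule (ZMod 3) V} (hW : W = Submodule.span (ZMod 3) {p, q, x})
    {a b : V} (haU : a ∈ U) (hbU : b ∈ U) (ha : a ∉ W) (hb : b ∉ W) (hab : a + b ∉ W)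
    (hab' : a - b ∉ W) (k1 k3 k4 : ℕ) (hc : chk k1 k3 k4 = true)
    (h1 : k1 + 1 ≤ (fib U W a).card) (h2 : 5 ≤ (fib U W b).card)
    (h3 : k3 ≤ (fib U W (-(a + b))).card) (h4 : k4 ≤ (fib U W (a - b)).card) : False := by
  have hpW : p ∈ W := hW ▸ Submodule.subset_span (by simp)
  have hqW : q ∈ W := hW ▸ Submodule.subset_span (by simp)
  have hxW : x ∈ W := hW ▸ Submodule.subset_span (by simp)
  have hψ := psi_mem hpW hqW hxW
  have h3a := three_add a
  have h3b := three_add b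
  have hn : -(a + b) ∉ W := by rwa [neg_mem_iff]
  obtain ⟨X, aX, cX, mX, zX⟩ := exists_codes h hp hq hx hs a (hW ▸ ha)
  obtain ⟨Y, aY, cY, mY, zY⟩ := exists_codes h hp hq hx hs b (hW ▸ hb)
  obtain ⟨Z, aZ, cZ, mZ, -⟩ := exists_codes h hp hq hx hs (-(a + b)) (hW ▸ hn)
  obtain ⟨T, aT, cT, mT, -⟩ := exists_codes h hp hq hx hs (a - b) (hW ▸ hab')
  rw [← hW] at cX cY cZ cT
  refine chk_sound k1 k3 k4 hc aX aY aZ aT (zX haU) (zY hbU) (by omega) (by omega) (by omega)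
    (by omega) ?_ ?_ ?_ ?_
  · intro m hm n hn hk
    have := h.neg _ (mZ _ hk)
    rw [psi_th p q x (aX.lt m hm) (aY.lt n hn)] at this
    refine (sep h (hψ m) (hψ n) hab' hab (mX m hm) (mY n hn)).1 ?_
    convert this using 1
    abel
  · intro m hm n hn hk
    have := mT _ hk
    rw [psi_sub p q x (aX.lt m hm) (aY.lt n hn)] at this
    refine (sep h (hψ m) (hψ n) hab' hab (mX m hm) (mY n hn)).2 ?_
    convert this using 1
    abel
  · intro m hm n hn hk
    have := mT _ hk
    rw [psi_sub p q x (aY.lt m hm) (aZ.lt n hn)] at this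
    have e1 : b - -(a + b) = a - b := by
      have : b - -(a + b) = (a - b) + (b + b + b) := by abel
      rw [this, h3b, add_zero]
    have e2 : b + -(a + b) = -a := by abel
    refine (sep h (hψ m) (hψ n) (e1 ▸ hab') (by rwa [e2, neg_mem_iff]) (mY m hm) (mZ n hn)).2 ?_
    convert this using 1
    rw [← e1]; abel
  · intro m hm n hn hk
    have := mT _ hk
    rw [psi_sub p q x (aZ.lt m hm) (aX.lt n hn)] at this
    have e1 : -(a + b) - a = a - b := by
      have : -(a + b) - a = (a - b) - (a + a + a) := by abel
      rw [this, h3a, sub_zero]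
    have e2 : -(a + b) + a = -b := by abel
    refine (sep h (hψ m) (hψ n) (e1 ▸ hab') (by rwa [e2, neg_mem_iff]) (mZ m hm) (mX n hn)).2 ?_
    convert this using 1
    rw [← e1]; abel
end

section
variable {V : Type*} [AddCommGroup V] [Module (ZMod 3) V] [DecidableEq V]

open Classical in
/-- size of the fibre of the cap over a class -/
noncomputable def NN (U : Finset V) (W : Submodule (ZMod 3) V) (c : V ⧸ W) : ℕ :=
  (U.filter (fun u => Submodule.Quotient.mk (p := W) u = c)).card

theorem NN_mk (U : Finset V) (W : Submodule (ZMod 3) V) (a : V) :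
    NN U W (Submodule.Quotient.mk a) = (fib U W a).card := by
  classical
  unfold NN fib
  congr 1
  ext u
  simp only [Finset.mem_filter, Submodule.Quotient.eq]

theorem NN_neg {U : Finset V} (h : Cap U) (W : Submodule (ZMod 3) V) (c : V ⧸ W) :
    NN U W (-c) = NN U W c := by
  classical
  unfold NN
  refine Finset.card_nbij' (fun u => -u) (fun u => -u) ?_ ?_ ?_ ?_
  · intro u hu
    simp only [Finset.coe_filter, Set.mem_ofPred_eq] at hu ⊢
    exact ⟨h.neg u hu.1, by rw [Submodule.Quotient.mk_neg, hu.2, neg_neg]⟩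
  · intro u hu
    simp only [Finset.coe_filter, Set.mem_ofPred_eq] at hu ⊢
    exact ⟨h.neg u hu.1, by rw [Submodule.Quotient.mk_neg, hu.2]⟩
  · intro u _; simp
  · intro u _; simp

theorem exists_of_NN {U : Finset V} {W : Submodule (ZMod 3) V} {c : V ⧸ W} (hc : 0 < NN U W c) :
    ∃ a ∈ U, Submodule.Quotient.mk a = c := by
  classical
  obtain ⟨a, ha⟩ := Finset.card_pos.1 hc
  exact ⟨a, (Finset.mem_filter.1 ha).1, (Finset.mem_filter.1 ha).2⟩

theorem NN_zero [Finite V] {U : Finset V} (h : Cap U) (W : Submodule (ZMod 3) V)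
    (hW : Module.finrank (ZMod 3) W = 3) : NN U W 0 ≤ 8 := by
  classical
  have : Fintype W := Fintype.ofFinite _
  let U' : Finset W := Finset.univ.filter (fun w => (w : V) ∈ U)
  have hU' : Cap U' := by
    refine ⟨?_, ?_, ?_⟩
    · simpa [U'] using h.zero
    · intro x hx
      simp only [U', Finset.mem_filter, Finset.mem_univ, true_and] at hx ⊢
      simpa using h.neg _ hx
    · intro x hx y hy h1 h2
      simp only [U', Finset.mem_filter, Finset.mem_univ, true_and] at hx hy ⊢
      refine h.cap _ hx _ hy (fun e => h1 (Subtype.ext e)) (fun e => h2 (Subtype.ext e))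
  have hb := cap_bound hU' (r := 1) hW
  refine le_trans ?_ (hb.trans (by norm_num))
  have : U.filter (fun u => Submodule.Quotient.mk (p := W) u = 0) ⊆
      U'.image (fun w : W => (w : V)) := by
    intro u hu
    rw [Finset.mem_filter, Submodule.Quotient.mk_eq_zero] at hu
    exact Finset.mem_image.2 ⟨⟨u, hu.2⟩, by simp [U', hu.1], rfl⟩
  exact (Finset.card_le_card this).trans Finset.card_image_le

theorem cap5_aux [Finite V] (hr : Module.finrank (ZMod 3) V = 5) {U : Finset V} (h : Cap U)
    (hU : 46 ≤ U.card) {p q x : V} (hp : p ∈ U) (hq : q ∈ U) (hx : x ∈ U)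
    (hs : p + q + x ∈ U) (hpq : p ≠ q) (hpq' : p ≠ -q)
    (hxs : x ∉ Submodule.span (ZMod 3) {p, q}) : False := by
  classical
  obtain ⟨W, hW⟩ : ∃ W, W = Submodule.span (ZMod 3) {p, q, x} := ⟨_, rfl⟩
  have hW3 : Module.finrank (ZMod 3) W = 3 := by
    have h2 := finrank_pair (fun e => h.zero (e ▸ hp)) (fun e => h.zero (e ▸ hq)) hpq hpq'
    have hlt : Submodule.span (ZMod 3) {p, q} < W := by
      rw [hW]
      refine lt_of_le_of_ne (Submodule.span_mono ?_) ?_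
      · intro y; simp only [Set.mem_insert_iff, Set.mem_singleton_iff]; tauto
      · intro e
        apply hxs
        rw [e]
        exact Submodule.subset_span (by simp)
    have h3 := Submodule.finrank_lt_finrank_of_lt hlt
    have h4 : Module.finrank (ZMod 3) W ≤ 3 := by
      have := finrank_span_finset_le_card (R := ZMod 3) ({p, q, x} : Finset V)
      have e : W = Submodule.span (ZMod 3) (({p, q, x} : Finset V) : Set V) := by
        rw [hW]; simp
      rw [e]
      exact this.trans Finset.card_le_three
    omega
  have : Finite (V ⧸ W) := Finite.of_surjective _ (Submodule.Quotient.mk_surjective W)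
  have : Fintype (V ⧸ W) := Fintype.ofFinite _
  have hcard : Fintype.card (V ⧸ W) = 9 := card_quot W (r := 2) hr hW3
  have hsum : 46 ≤ ∑ c : V ⧸ W, NN U W c := by
    rw [card_eq_sum_fib U W] at hU
    exact hU
  have h0 := NN_zero h W hW3
  have h6 : ∀ c : V ⧸ W, c ≠ 0 → NN U W c ≤ 6 := by
    intro c hc
    by_cases hpos : 0 < NN U W c
    · obtain ⟨a, haU, rfl⟩ := exists_of_NN hpos
      have ha : a ∉ W := fun hm => hc ((Submodule.Quotient.mk_eq_zero W).2 hm)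
      obtain ⟨X, aX, cX, -, zX⟩ := exists_codes h hp hq hx hs a (hW ▸ ha)
      rw [NN_mk, hW, ← cX]
      exact card_le_six aX (zX haU)
    · omega
  have hneg : ∀ c : V ⧸ W, c ≠ 0 → c ≠ -c := by
    intro c hc e
    apply hc
    have := three_add c
    have h2 : c + c = 0 := by rwa [← eq_neg_iff_add_eq_zero]
    rwa [h2, zero_add] at this
  obtain ⟨c1, hc1, hN1⟩ : ∃ c1 : V ⧸ W, c1 ≠ 0 ∧ 5 ≤ NN U W c1 := by
    by_contra! hcon
    rw [← Finset.add_sum_erase _ _ (Finset.mem_univ (0 : V ⧸ W))] at hsum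
    have := Finset.sum_le_card_nsmul (Finset.univ.erase (0 : V ⧸ W)) (fun c => NN U W c) 4
      (fun c hc => Nat.lt_succ_iff.1 (hcon c (Finset.ne_of_mem_erase hc)))
    rw [Finset.card_erase_of_mem (Finset.mem_univ _), Finset.card_univ, hcard, smul_eq_mul] at this
    omega
  obtain ⟨c2, hc2, hc21, hc21', hN2⟩ : ∃ c2 : V ⧸ W, c2 ≠ 0 ∧ c2 ≠ c1 ∧ c2 ≠ -c1 ∧
      5 ≤ NN U W c2 := by
    by_contra! hcon
    have m1 : c1 ∈ Finset.univ.erase (0 : V ⧸ W) := by simp [hc1]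
    have m2 : -c1 ∈ (Finset.univ.erase (0 : V ⧸ W)).erase c1 := by
      simp [hc1, (hneg c1 hc1).symm]
    rw [← Finset.add_sum_erase _ _ (Finset.mem_univ (0 : V ⧸ W)),
      ← Finset.add_sum_erase _ _ m1, ← Finset.add_sum_erase _ _ m2] at hsum
    have := Finset.sum_le_card_nsmul (((Finset.univ.erase (0 : V ⧸ W)).erase c1).erase (-c1))
      (fun c => NN U W c) 4
      (fun c hc => by
        simp only [Finset.mem_erase, Finset.mem_univ, and_true] at hc
        exact Nat.lt_succ_iff.1 (hcon c hc.2.2 hc.2.1 hc.1))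
    rw [Finset.card_erase_of_mem m2, Finset.card_erase_of_mem m1,
      Finset.card_erase_of_mem (Finset.mem_univ _), Finset.card_univ, hcard, smul_eq_mul] at this
    have e1 := h6 c1 hc1
    have e2 := h6 (-c1) (neg_ne_zero.2 hc1)
    omega
  have hadd : c1 + c2 ≠ 0 := fun e => hc21' (by rw [eq_neg_iff_add_eq_zero, add_comm, e])
  have hsub : c1 - c2 ≠ 0 := fun e => hc21 (sub_eq_zero.1 e).symm
  -- expand the sum
  have hinj : Function.Injective (fun t : ZMod 3 × ZMod 3 => t.1 • c1 + t.2 • c2) := by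
    have key : ∀ a b : ZMod 3, a • c1 + b • c2 = 0 → a = 0 ∧ b = 0 := by
      intro a b hab
      have n1 : -c1 + c2 ≠ 0 := fun e => hc21 (by rw [neg_add_eq_zero] at e; exact e.symm)
      have n2 : -c1 + -c2 ≠ 0 := fun e => hadd (by
        rw [← neg_add_rev, neg_eq_zero, add_comm] at e; exact e)
      have n3 : c1 + -c2 ≠ 0 := fun e => hsub (by rw [sub_eq_add_neg]; exact e)
      rcases zmod3_cases a with rfl | rfl | rfl <;> rcases zmod3_cases b with rfl | rfl | rfl <;>
        simp_all
    rintro ⟨a, b⟩ ⟨a', b'⟩ e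
    have e : a • c1 + b • c2 = a' • c1 + b' • c2 := e
    have : (a - a') • c1 + (b - b') • c2 = 0 := by
      rw [sub_smul, sub_smul]
      rw [← sub_eq_zero] at e
      rw [← e]; abel
    obtain ⟨k1, k2⟩ := key _ _ this
    rw [Prod.mk.injEq]
    exact ⟨sub_eq_zero.1 k1, sub_eq_zero.1 k2⟩
  have hbij : Function.Bijective (fun t : ZMod 3 × ZMod 3 => t.1 • c1 + t.2 • c2) := by
    rw [Fintype.bijective_iff_injective_and_card]
    refine ⟨hinj, ?_⟩
    rw [hcard]; decide
  have hexp : ∑ c : V ⧸ W, NN U W c = NN U W 0 + 2 * NN U W c1 + 2 * NN U W c2 +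
      2 * NN U W (c1 + c2) + 2 * NN U W (c1 - c2) := by
    rw [← hbij.sum_comp (NN U W), Fintype.sum_prod_type]
    have hu : ∀ f : ZMod 3 → ℕ, ∑ i, f i = f 0 + f 1 + f (-1) := by
      intro f
      exact Fin.sum_univ_three f
    simp only [hu, zero_smul, one_smul, neg_smul, zero_add, add_zero]
    have e1 : -c1 + c2 = -(c1 - c2) := by abel
    have e2 : -c1 + -c2 = -(c1 + c2) := by abel
    have e3 : c1 + -c2 = c1 - c2 := by abel
    rw [e1, e2, e3]
    simp only [NN_neg h]
    ring
  have h61 := h6 c1 hc1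
  have h62 := h6 c2 hc2
  have h63 := h6 _ hadd
  have h64 := h6 _ hsub
  -- main application
  have main : ∀ d1 d2 : V ⧸ W, d1 ≠ 0 → d2 ≠ 0 → d1 + d2 ≠ 0 → d1 - d2 ≠ 0 → ∀ k1 k3 k4,
      chk k1 k3 k4 = true → k1 + 1 ≤ NN U W d1 → 5 ≤ NN U W d2 → k3 ≤ NN U W (d1 + d2) →
      k4 ≤ NN U W (d1 - d2) → False := by
    intro d1 d2 hd1 hd2 ha hs' k1 k3 k4 hc g1 g2 g3 g4
    obtain ⟨a, haU, rfl⟩ := exists_of_NN (lt_of_lt_of_le (Nat.succ_pos k1) g1)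
    obtain ⟨b, hbU, rfl⟩ := exists_of_NN (lt_of_lt_of_le (by norm_num) g2)
    rw [← NN_neg h] at g3
    rw [← Submodule.Quotient.mk_add, ← Submodule.Quotient.mk_neg, NN_mk] at g3
    rw [← Submodule.Quotient.mk_sub, NN_mk] at g4
    rw [NN_mk] at g1 g2
    rw [Ne, Submodule.Quotient.mk_eq_zero] at hd1 hd2
    rw [← Submodule.Quotient.mk_add, Ne, Submodule.Quotient.mk_eq_zero] at ha
    rw [← Submodule.Quotient.mk_sub, Ne, Submodule.Quotient.mk_eq_zero] at hs'
    exact final h hp hq hx hs hW haU hbU hd1 hd2 ha hs' k1 k3 k4 hc g1 g2 g3 g4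
  have hsub' : c2 - c1 ≠ 0 := fun e => hc21 (sub_eq_zero.1 e)
  have hadd' : c2 + c1 ≠ 0 := by rwa [add_comm]
  have hn2 := neg_ne_zero.2 hc2
  have hn1 := neg_ne_zero.2 hc1
  have s1 : NN U W (c2 - c1) = NN U W (c1 - c2) := by rw [← NN_neg h, neg_sub]
  have s2 : NN U W (c2 + c1) = NN U W (c1 + c2) := by rw [add_comm]
  have t1 : NN U W (c1 + -c2) = NN U W (c1 - c2) := by rw [← sub_eq_add_neg]
  have t2 : NN U W (c1 - -c2) = NN U W (c1 + c2) := by rw [sub_neg_eq_add]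
  have t3 : NN U W (c2 + -c1) = NN U W (c1 - c2) := by rw [← sub_eq_add_neg, s1]
  have t4 : NN U W (c2 - -c1) = NN U W (c1 + c2) := by rw [sub_neg_eq_add, s2]
  have u1 := NN_neg h W c1
  have u2 := NN_neg h W c2
  have hp1 : c1 + -c2 ≠ 0 := by rwa [← sub_eq_add_neg]
  have hp2 : c1 - -c2 ≠ 0 := by rwa [sub_neg_eq_add]
  have hp3 : c2 + -c1 ≠ 0 := by rwa [← sub_eq_add_neg]
  have hp4 : c2 - -c1 ≠ 0 := by rwa [sub_neg_eq_add]
  have A1 := main c1 c2 hc1 hc2 hadd hsub 4 5 1 chkA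
  have A2 := main c1 (-c2) hc1 hn2 hp1 hp2 4 5 1 chkA
  have B1 := main c1 c2 hc1 hc2 hadd hsub 5 4 3 chkB
  have B2 := main c1 (-c2) hc1 hn2 hp1 hp2 5 4 3 chkB
  have B3 := main c2 c1 hc2 hc1 hadd' hsub' 5 4 3 chkB
  have B4 := main c2 (-c1) hc2 hn1 hp3 hp4 5 4 3 chkB
  rw [t1, t2, u2] at A2 B2
  rw [s1, s2] at B3
  rw [t3, t4, u1] at B4
  rw [hexp] at hsum
  generalize NN U W c1 = n1 at *
  generalize NN U W c2 = n2 at *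
  generalize NN U W (c1 + c2) = n3 at *
  generalize NN U W (c1 - c2) = n4 at *
  by_cases q3 : 5 ≤ n3
  · exact A1 (by omega) (by omega) (by omega) (by omega)
  · by_cases q4 : 5 ≤ n4
    · exact A2 (by omega) (by omega) (by omega) (by omega)
    · by_cases q1 : 6 ≤ n1
      · by_cases q5 : n3 = 4
        · exact B1 (by omega) (by omega) (by omega) (by omega)
        · exact B2 (by omega) (by omega) (by omega) (by omega)
      · by_cases q5 : n3 = 4
        · exact B3 (by omega) (by omega) (by omega) (by omega)
        · exact B4 (by omega) (by omega) (by omega) (by omega)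

theorem cap5 [Finite V] (hr : Module.finrank (ZMod 3) V = 5) {U : Finset V} (h : Cap U) :
    U.card < 46 := by
  classical
  by_contra! hU
  obtain ⟨p, hp, q, hq, hpq, hpq'⟩ := exists_pair (U := U) (by omega)
  obtain ⟨W, hWd⟩ : ∃ W, W = Submodule.span (ZMod 3) {p, q} := ⟨_, rfl⟩
  have : Finite (V ⧸ W) := Finite.of_surjective _ (Submodule.Quotient.mk_surjective W)
  have : Fintype (V ⧸ W) := Fintype.ofFinite _
  have hW : Module.finrank (ZMod 3) W = 2 := by
    rw [hWd]
    exact finrank_pair (fun e => h.zero (e ▸ hp)) (fun e => h.zero (e ▸ hq)) hpq hpq'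
  have hcard : Fintype.card (V ⧸ W) = 27 := card_quot W (r := 3) hr hW
  have hsum : 46 ≤ ∑ c : V ⧸ W, NN U W c := by
    rw [card_eq_sum_fib U W] at hU
    exact hU
  have h0 : NN U W 0 ≤ 4 := by subst hWd; exact fib2_zero h hp hq hpq hpq'
  obtain ⟨c, hc, hN⟩ : ∃ c : V ⧸ W, c ≠ 0 ∧ 1 < NN U W c := by
    by_contra! hcon
    rw [← Finset.add_sum_erase _ _ (Finset.mem_univ (0 : V ⧸ W))] at hsum
    have := Finset.sum_le_card_nsmul (Finset.univ.erase (0 : V ⧸ W)) (fun c => NN U W c) 1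
      (fun c hc => hcon c (Finset.ne_of_mem_erase hc))
    rw [Finset.card_erase_of_mem (Finset.mem_univ _), Finset.card_univ, hcard, smul_eq_mul] at this
    omega
  obtain ⟨x, hx, y, hy, hxy⟩ := Finset.one_lt_card.1 hN
  obtain ⟨hx, hxc⟩ := Finset.mem_filter.1 hx
  obtain ⟨hy, hyc⟩ := Finset.mem_filter.1 hy
  have hxW : x ∉ W := by
    intro hm
    rw [← Submodule.Quotient.mk_eq_zero, hxc] at hm
    exact hc hm
  have h1 : y - x ∈ W := (Submodule.Quotient.eq _).1 (hyc.trans hxc.symm)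
  have n1 := eq_neg_of_mem hxW h1
  rw [hWd] at h1
  obtain ⟨a, b, hab⟩ := Submodule.mem_span_pair.1 h1
  obtain ⟨ha, hb⟩ := fib2_aux h hp hq hx hy hxy n1 hab
  refine cap5_aux hr h hU (p := a • p) (q := b • q) (x := x) (h.smul_mem hp ha) (h.smul_mem hq hb)
    hx (by rw [hab]; simpa using hy) ?_ ?_ ?_
  · rcases zmod3_cases a with rfl | rfl | rfl <;> rcases zmod3_cases b with rfl | rfl | rfl <;>
      simp_all [neg_eq_iff_eq_neg]
  · rcases zmod3_cases a with rfl | rfl | rfl <;> rcases zmod3_cases b with rfl | rfl | rfl <;>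
      simp_all [neg_eq_iff_eq_neg]
  · intro hm
    apply hxW
    rw [hWd]
    refine Submodule.span_le.2 ?_ hm
    rintro z hz
    simp only [Set.mem_insert_iff, Set.mem_singleton_iff] at hz
    rcases hz with rfl | rfl
    · exact Submodule.smul_mem _ _ (Submodule.subset_span (by simp))
    · exact Submodule.smul_mem _ _ (Submodule.subset_span (by simp))
end

section
variable {V : Type*} [AddCommGroup V] [Module (ZMod 3) V] [DecidableEq V]

theorem wz1 {S : Multiset V} {a : V} (h : ({a} : Multiset V) ≤ S) (e : a = 0) : HasWZSS S 1 :=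
  ⟨{a}, 0, by simpa using h, by simp, by simpa using e⟩

theorem wz2 {S : Multiset V} {a b : V} (h : ({a, b} : Multiset V) ≤ S) (e : a = b ∨ a = -b) :
    HasWZSS S 2 := by
  rcases e with e | e
  · exact ⟨{a}, {b}, by simpa [Multiset.singleton_add] using h, by simp, by simpa using e⟩
  · exact ⟨{a, b}, 0, by simpa using h, by simp, by simp [e]⟩

theorem wz3 {S : Multiset V} {a b c : V} (h : ({a, b, c} : Multiset V) ≤ S)
    (e : a + b = c ∨ a + b = -c) : HasWZSS S 3 := by
  rcases e with e | e
  · refine ⟨{a, b}, {c}, by simpa using h, by simp, by simpa using e⟩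
  · refine ⟨{a, b, c}, 0, by simpa using h, by simp, ?_⟩
    have : a + (b + c) = 0 := by rw [← add_assoc, e]; simp
    simpa using this

theorem triple_le {S : Multiset V} {a b c : V} (ha : a ∈ S) (hb : b ∈ S) (hc : c ∈ S)
    (hab : a ≠ b) (hac : a ≠ c) (hbc : b ≠ c) : ({a, b, c} : Multiset V) ≤ S := by
  rw [Multiset.le_iff_subset (by simp [hab, hac, hbc])]
  intro x hx
  simp only [Multiset.insert_eq_cons, Multiset.mem_cons, Multiset.mem_singleton] at hx
  rcases hx with rfl | rfl | rfl <;> assumption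

theorem pair_le {S : Multiset V} {a b : V} (ha : a ∈ S) (hb : b ∈ S)
    (hab : a ≠ b) : ({a, b} : Multiset V) ≤ S := by
  rw [Multiset.le_iff_subset (by simp [hab])]
  intro x hx
  simp only [Multiset.insert_eq_cons, Multiset.mem_cons, Multiset.mem_singleton] at hx
  rcases hx with rfl | rfl <;> assumption

theorem exists_cap {S : Multiset V} (h1 : ¬ HasWZSS S 1) (h2 : ¬ HasWZSS S 2)
    (h3 : ¬ HasWZSS S 3) : ∃ U : Finset V, Cap U ∧ U.card = 2 * Multiset.card S := by
  have hz : (0 : V) ∉ S := fun h => h1 (wz1 (Multiset.singleton_le.2 h) rfl)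
  have hnd : S.Nodup := by
    rw [Multiset.nodup_iff_le]
    intro a ha
    exact h2 (wz2 ha (Or.inl rfl))
  have hne : ∀ a ∈ S, ∀ b ∈ S, a ≠ -b := by
    intro a ha b hb e
    by_cases hab : a = b
    · subst hab
      have := three_add a
      have h2 : a + a = 0 := by rwa [← eq_neg_iff_add_eq_zero]
      rw [h2, zero_add] at this
      exact hz (this ▸ ha)
    · exact h2 (wz2 (pair_le ha hb hab) (Or.inr e))
  have h3' : ∀ a ∈ S, ∀ b ∈ S, ∀ c ∈ S, a ≠ b → a ≠ c → b ≠ c → a + b ≠ c ∧ a + b ≠ -c := by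
    intro a ha b hb c hc hab hac hbc
    constructor
    · exact fun e => h3 (wz3 (triple_le ha hb hc hab hac hbc) (Or.inl e))
    · exact fun e => h3 (wz3 (triple_le ha hb hc hab hac hbc) (Or.inr e))
  have hadd : ∀ a ∈ S, ∀ b ∈ S, a ≠ b → a + b ∉ S ∧ -(a + b) ∉ S := by
    intro a ha b hb hab
    constructor
    · intro hc
      refine (h3' a ha b hb _ hc hab ?_ ?_).1 rfl
      · intro e; exact hz ((left_eq_add.1 e) ▸ hb)
      · intro e; exact hz ((right_eq_add.1 e) ▸ ha)
    · intro hc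
      refine (h3' a ha b hb _ hc hab ?_ ?_).2 (by simp)
      · intro e
        apply hab
        have h4 : a + a + b = 0 := by
          have := eq_neg_iff_add_eq_zero.1 e
          rwa [← add_assoc] at this
        have h5 := three_add a
        exact (add_left_cancel (h4.trans h5.symm)).symm
      · intro e
        apply hab
        have h4 : b + b + a = 0 := by
          have := eq_neg_iff_add_eq_zero.1 e
          rw [← this]; abel
        have h5 := three_add b
        exact add_left_cancel (h4.trans h5.symm)
  have hsub : ∀ a ∈ S, ∀ b ∈ S, a ≠ b → a - b ∉ S := by
    intro a ha b hb hab hc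
    by_cases e : a - b = b
    · apply hne a ha b hb
      have : a = b + b := sub_eq_iff_eq_add.1 e
      rw [this, eq_neg_iff_add_eq_zero, three_add]
    · exact (hadd _ hc b hb e).1 (by simpa using ha)
  have memU : ∀ x, x ∈ S.toFinset ∪ S.toFinset.image (fun v => -v) ↔ x ∈ S ∨ -x ∈ S := by
    intro x
    rw [Finset.mem_union, Multiset.mem_toFinset, Finset.mem_image]
    refine or_congr_right ⟨?_, fun h => ⟨-x, by simpa using h, by simp⟩⟩
    rintro ⟨y, hy, rfl⟩
    simpa using hy
  refine ⟨S.toFinset ∪ S.toFinset.image (fun v => -v), ⟨?_, ?_, ?_⟩, ?_⟩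
  · rw [memU]; simpa using hz
  · intro x hx
    rw [memU] at hx ⊢
    rw [neg_neg]; exact hx.symm
  · intro x hx y hy hxy hxy' hs
    rw [memU] at hx hy hs
    have hxy'' : -x ≠ y := fun e => hxy' (by rw [← e, neg_neg])
    have hn : -x ≠ -y := fun e => hxy (neg_injective e)
    rcases hx with hx | hx <;> rcases hy with hy | hy
    · have := hadd x hx y hy hxy
      tauto
    · have k1 := hsub x hx (-y) hy hxy'
      have k2 := hsub (-y) hy x hx hxy'.symm
      rw [sub_neg_eq_add] at k1
      have e : -y - x = -(x + y) := by abel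
      rw [e] at k2
      tauto
    · have k1 := hsub y hy (-x) hx hxy''.symm
      have k2 := hsub (-x) hx y hy hxy''
      rw [sub_neg_eq_add, add_comm] at k1
      have e : -x - y = -(x + y) := by abel
      rw [e] at k2
      tauto
    · have := hadd (-x) hx (-y) hy hn
      have e : -x + -y = -(x + y) := by abel
      rw [e, neg_neg] at this
      tauto
  · rw [Finset.card_union_of_disjoint, Finset.card_image_of_injective _ neg_injective,
      Multiset.toFinset_card_of_nodup hnd]
    · ring
    · rw [Finset.disjoint_left]
      intro x hx hx'
      rw [Multiset.mem_toFinset] at hx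
      obtain ⟨y, hy, e⟩ := Finset.mem_image.1 hx'
      exact hne x hx y (Multiset.mem_toFinset.1 hy) e.symm

/-- Decidable criterion for a list to contain no short weighted zero-sum subsequence. -/
theorem no_wz {L : List V} (hnd : L.Nodup) (h1 : (0 : V) ∉ L)
    (h2 : ∀ a ∈ L, ∀ b ∈ L, a ≠ b → a + b ≠ 0 ∧ a + b ∉ L ∧ -(a + b) ∉ L)
    (k : ℕ) (hk1 : 1 ≤ k) (hk3 : k ≤ 3) : ¬ HasWZSS (L : Multiset V) k := by
  rintro ⟨t₁, t₂, hle, hc, hs⟩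
  have hnd' : (t₁ + t₂).Nodup := Multiset.nodup_of_le hle (by simpa using hnd)
  have hm : ∀ x ∈ t₁ + t₂, x ∈ L := fun x hx => by simpa using Multiset.mem_of_le hle hx
  rw [Multiset.card_add] at hc
  -- by symmetry assume `card t₂ ≤ card t₁`
  have key : ∀ s₁ s₂ : Multiset V, (s₁ + s₂).Nodup → (∀ x ∈ s₁ + s₂, x ∈ L) → s₁.sum = s₂.sum →
      Multiset.card s₁ + Multiset.card s₂ = k → Multiset.card s₂ ≤ Multiset.card s₁ → False := by
    intro s₁ s₂ hnd' hm hs hc hle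
    have hcases : (Multiset.card s₁ = 1 ∧ Multiset.card s₂ = 0) ∨
      (Multiset.card s₁ = 1 ∧ Multiset.card s₂ = 1) ∨
      (Multiset.card s₁ = 2 ∧ Multiset.card s₂ = 0) ∨
      (Multiset.card s₁ = 2 ∧ Multiset.card s₂ = 1) ∨
      (Multiset.card s₁ = 3 ∧ Multiset.card s₂ = 0) := by omega
    rcases hcases with ⟨e1, e2⟩ | ⟨e1, e2⟩ | ⟨e1, e2⟩ | ⟨e1, e2⟩ | ⟨e1, e2⟩
    · obtain ⟨a, rfl⟩ := Multiset.card_eq_one.1 e1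
      rw [Multiset.card_eq_zero] at e2
      subst e2
      simp at hs hm
      exact h1 (hs ▸ hm)
    · obtain ⟨a, rfl⟩ := Multiset.card_eq_one.1 e1
      obtain ⟨b, rfl⟩ := Multiset.card_eq_one.1 e2
      simp at hs hnd'
      exact hnd' hs
    · obtain ⟨a, b, rfl⟩ := Multiset.card_eq_two.1 e1
      rw [Multiset.card_eq_zero] at e2
      subst e2
      simp at hs hm hnd'
      exact (h2 a hm.1 b hm.2 hnd').1 hs
    · obtain ⟨a, b, rfl⟩ := Multiset.card_eq_two.1 e1
      obtain ⟨c, rfl⟩ := Multiset.card_eq_one.1 e2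
      simp at hs hm hnd'
      refine (h2 a hm.1 b hm.2.1 ?_).2.1 (hs ▸ hm.2.2)
      tauto
    · obtain ⟨a, b, c, rfl⟩ := Multiset.card_eq_three.1 e1
      rw [Multiset.card_eq_zero] at e2
      subst e2
      simp at hs hm hnd'
      refine (h2 a hm.1 b hm.2.1 (by tauto)).2.2 ?_
      have : -(a + b) = c := by
        rw [neg_eq_iff_add_eq_zero, add_assoc]; exact hs
      rw [this]; exact hm.2.2
  rcases le_total (Multiset.card t₂) (Multiset.card t₁) with hle | hle
  · exact key t₁ t₂ hnd' hm hs hc hle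
  · exact key t₂ t₁ (by rwa [add_comm]) (by rwa [add_comm]) hs.symm (by omega) hle
end

theorem expo (r : ℕ) : AddMonoid.exponent (Fin (r + 1) → ZMod 3) = 3 := by
  have hd : AddMonoid.exponent (Fin (r + 1) → ZMod 3) ∣ 3 :=
    AddMonoid.exponent_dvd_of_forall_nsmul_eq_zero (fun v => nsmul3 v)
  rcases (Nat.dvd_prime Nat.prime_three).1 hd with h | h
  · rw [AddMonoid.exp_eq_one_iff] at h
    exact absurd h (not_subsingleton _)
  · exact h

theorem eta_mem (r n : ℕ) (hb : ∀ U : Finset (Fin (r + 1) → ZMod 3), Cap U → U.card < 2 * n) :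
    n ∈ {ℓ : ℕ | ∀ S : Multiset (Fin (r + 1) → ZMod 3), ℓ ≤ Multiset.card S →
      ∃ k, 1 ≤ k ∧ k ≤ AddMonoid.exponent (Fin (r + 1) → ZMod 3) ∧ HasWZSS S k} := by
  intro S hS
  rw [expo]
  by_contra! hcon
  obtain ⟨U, hU, hc⟩ := exists_cap (hcon 1 (by norm_num) (by norm_num))
    (hcon 2 (by norm_num) (by norm_num)) (hcon 3 (by norm_num) (by norm_num))
  have := hb U hU
  omega

theorem eta_le (r n : ℕ) (hb : ∀ U : Finset (Fin (r + 1) → ZMod 3), Cap U → U.card < 2 * n) :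
    etaA (Fin (r + 1) → ZMod 3) ≤ n :=
  Nat.sInf_le (eta_mem r n hb)

theorem le_eta (r n : ℕ) (m : ℕ) (hb : ∀ U : Finset (Fin (r + 1) → ZMod 3), Cap U → U.card < 2 * m)
    (L : List (Fin (r + 1) → ZMod 3)) (hL : L.length + 1 = n) (hnd : L.Nodup)
    (h1 : (0 : Fin (r + 1) → ZMod 3) ∉ L)
    (h2 : ∀ a ∈ L, ∀ b ∈ L, a ≠ b → a + b ≠ 0 ∧ a + b ∉ L ∧ -(a + b) ∉ L) :
    n ≤ etaA (Fin (r + 1) → ZMod 3) := by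
  refine le_csInf ⟨m, eta_mem r m hb⟩ ?_
  intro ℓ hℓ
  by_contra! hlt
  obtain ⟨k, hk1, hk2, hk⟩ := hℓ (L : Multiset (Fin (r + 1) → ZMod 3)) (by
    rw [Multiset.coe_card]; omega)
  rw [expo] at hk2
  exact no_wz hnd h1 h2 k hk1 hk2 hk

theorem bnd (r : ℕ) (U : Finset (Fin (r + 2) → ZMod 3)) (hU : Cap U) :
    U.card < 2 * (3 ^ r + 2) := by
  have := cap_bound hU (r := r) (by simp)
  omega

def cap10 : List (Fin 4 → ZMod 3) :=
  [![0, 0, 0, 1],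
   ![0, 0, 1, 0],
   ![0, 1, 1, 2],
   ![0, 1, 2, 1],
   ![1, 0, 1, 2],
   ![1, 0, 2, 1],
   ![1, 1, 1, 1],
   ![1, 1, 2, 2],
   ![1, 2, 1, 1],
   ![1, 2, 2, 2]]
def cap20 : List (Fin 5 → ZMod 3) :=
  [![0, 0, 0, 1, 1],
   ![0, 0, 0, 2, 1],
   ![0, 0, 1, 0, 1],
   ![0, 0, 2, 0, 1],
   ![0, 1, 1, 2, 1],
   ![0, 1, 2, 1, 1],
   ![0, 2, 1, 2, 1],
   ![0, 2, 2, 1, 1],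
   ![1, 0, 1, 2, 1],
   ![1, 0, 2, 1, 1],
   ![1, 1, 1, 1, 1],
   ![1, 1, 2, 2, 1],
   ![1, 2, 1, 1, 1],
   ![1, 2, 2, 2, 1],
   ![2, 0, 1, 2, 1],
   ![2, 0, 2, 1, 1],
   ![2, 1, 1, 1, 1],
   ![2, 1, 2, 2, 1],
   ![2, 2, 1, 1, 1],
   ![2, 2, 2, 2, 1]]

/-- Proposition 6: `η_A(C_3^2) = 3`, `η_A(C_3^3) = 5`,
`η_A(C_3^4) = 11` and `21 ≤ η_A(C_3^5) ≤ 23`. -/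
theorem etaA_small_values :
    etaA (Fin 2 → ZMod 3) = 3 ∧ etaA (Fin 3 → ZMod 3) = 5 ∧
    etaA (Fin 4 → ZMod 3) = 11 ∧
    (21 ≤ etaA (Fin 5 → ZMod 3) ∧ etaA (Fin 5 → ZMod 3) ≤ 23) := by
  have b5 : ∀ U : Finset (Fin 5 → ZMod 3), Cap U → U.card < 2 * 23 :=
    fun U hU => cap5 (by simp) hU
  refine ⟨le_antisymm (eta_le 1 3 (bnd 0)) (le_eta 1 3 3 (bnd 0) [![1, 0], ![0, 1]] rfl ?_ ?_ ?_),
    le_antisymm (eta_le 2 5 (bnd 1)) (le_eta 2 5 5 (bnd 1)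
      [![1, 0, 0], ![0, 1, 0], ![0, 0, 1], ![1, 1, 1]] rfl ?_ ?_ ?_),
    le_antisymm (eta_le 3 11 (bnd 2)) (le_eta 3 11 11 (bnd 2) cap10 rfl ?_ ?_ ?_),
    le_eta 4 21 23 b5 cap20 rfl ?_ ?_ ?_, eta_le 4 23 b5⟩
  all_goals decide +kernel
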